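/- Fix d ∈ {−1, 1}, M₁, M₂, ε ∈ ℝ, and let P(t) = M₁ + M₂ t + d t³. Let f(x,y) = (x̄, ȳ) with ȳ = −x + P(y·(1 + εx)) and x̄ = y·(1 + εx)/(1 + εȳ), defined where 1 + εȳ ≠ 0. Then at every point (x,y) with 1 + εȳ ≠ 0, f is differentiable and the determinant of its Jacobian matrix equals (1 + εx)/(1 + εȳ), where ȳ = −x + P(y(1+εx)). In particular, for ε ≠ 0 this determinant is not identically 1, so the perturbed map is non-conservative, while for ε = 0 the map coincides with the conservative cubic Hénon map H₃^d. -/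

import Mathlib

/-- The cubic polynomial `P(t) = M₁ + M₂·t + d·t³`. -/
def cubicP (d M₁ M₂ : ℝ) : ℝ → ℝ := fun t => M₁ + M₂ * t + d * t ^ 3

/-- The explicit form of the reversible non-conservative perturbation
`H̃₃^d(ε)` of the cubic Hénon map: `f(x,y) = (x̄, ȳ)` with
`ȳ = -x + P(y(1 + εx))` and `x̄ = y(1 + εx)/(1 + εȳ)`. -/
noncomputable def perturbedH3 (d M₁ M₂ ε : ℝ) : ℝ × ℝ → ℝ × ℝ := fun p =>
  let yb := -p.1 + cubicP d M₁ M₂ (p.2 * (1 + ε * p.1))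
  (p.2 * (1 + ε * p.1) / (1 + ε * yb), yb)

/-- The determinant of an endomorphism of `R × R` in terms of the images of the standard basis. -/
theorem LinearMap.det_prod_self {R : Type*} [CommRing R] (L : R × R →ₗ[R] R × R) :
    LinearMap.det L = (L (1, 0)).1 * (L (0, 1)).2 - (L (0, 1)).1 * (L (1, 0)).2 := by
  rw [← LinearMap.det_toMatrix (Module.Basis.finTwoProd R), Matrix.det_fin_two]
  simp [LinearMap.toMatrix_apply]

theorem hasDerivAt_cubicP (d M₁ M₂ t : ℝ) :
    HasDerivAt (cubicP d M₁ M₂) (M₂ + 3 * d * t ^ 2) t := by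
  have h := (((hasDerivAt_id t).const_mul M₂).const_add M₁).add
    ((hasDerivAt_pow 3 t).const_mul d)
  refine h.congr_deriv ?_
  push_cast
  ring

theorem perturbedH3_differentiableAt_and_det (d M₁ M₂ ε : ℝ) (p : ℝ × ℝ)
    (hp : 1 + ε * (-p.1 + cubicP d M₁ M₂ (p.2 * (1 + ε * p.1))) ≠ 0) :
    DifferentiableAt ℝ (perturbedH3 d M₁ M₂ ε) p ∧
      LinearMap.det (↑(fderiv ℝ (perturbedH3 d M₁ M₂ ε) p) : (ℝ × ℝ) →ₗ[ℝ] ℝ × ℝ) =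
        (1 + ε * p.1) / (1 + ε * (-p.1 + cubicP d M₁ M₂ (p.2 * (1 + ε * p.1)))) := by
  have hx : HasFDerivAt (fun q : ℝ × ℝ => q.1) (ContinuousLinearMap.fst ℝ ℝ ℝ) p := hasFDerivAt_fst
  have hy : HasFDerivAt (fun q : ℝ × ℝ => q.2) (ContinuousLinearMap.snd ℝ ℝ ℝ) p := hasFDerivAt_snd
  have hu := hy.mul ((hx.const_mul ε).const_add 1)
  have hv := hx.neg.add ((hasDerivAt_cubicP d M₁ M₂ _).comp_hasFDerivAt p hu)
  have hw := hu.mul ((hasDerivAt_inv hp).comp_hasFDerivAt p ((hv.const_mul ε).const_add 1))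
  have hf : HasFDerivAt (perturbedH3 d M₁ M₂ ε) _ p := hw.prodMk hv
  refine ⟨hf.differentiableAt, ?_⟩
  rw [hf.fderiv, LinearMap.det_prod_self]
  simp
  generalize cubicP d M₁ M₂ (p.2 * (1 + ε * p.1)) = c at hp ⊢
  field_simp
  ring

/-- at every point with `1 + εȳ ≠ 0` the perturbed map is
differentiable with Jacobian determinant `(1 + εx)/(1 + εȳ)`, where
`ȳ = -x + P(y(1 + εx))`; for `ε ≠ 0` this determinant is not identically `1`
(the map is non-conservative), while for `ε = 0` the map coincides with the
conservative cubic Hénon map `H₃^d`. -/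
theorem perturbedH3_jacobian (d M₁ M₂ ε : ℝ) (hd : d = -1 ∨ d = 1) :
    (∀ p : ℝ × ℝ, 1 + ε * (-p.1 + cubicP d M₁ M₂ (p.2 * (1 + ε * p.1))) ≠ 0 →
      DifferentiableAt ℝ (perturbedH3 d M₁ M₂ ε) p ∧
      LinearMap.det (↑(fderiv ℝ (perturbedH3 d M₁ M₂ ε) p) : (ℝ × ℝ) →ₗ[ℝ] ℝ × ℝ) =
        (1 + ε * p.1) / (1 + ε * (-p.1 + cubicP d M₁ M₂ (p.2 * (1 + ε * p.1))))) ∧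
    (ε ≠ 0 → ∃ p : ℝ × ℝ, 1 + ε * (-p.1 + cubicP d M₁ M₂ (p.2 * (1 + ε * p.1))) ≠ 0 ∧
      LinearMap.det (↑(fderiv ℝ (perturbedH3 d M₁ M₂ ε) p) : (ℝ × ℝ) →ₗ[ℝ] ℝ × ℝ) ≠ 1) ∧
    (ε = 0 → perturbedH3 d M₁ M₂ ε =
      fun p : ℝ × ℝ => (p.2, -p.1 + M₁ + M₂ * p.2 + d * p.2 ^ 3)) := by
  refine ⟨perturbedH3_differentiableAt_and_det d M₁ M₂ ε, fun hε => ?_, ?_⟩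
  · obtain ⟨p, hp, hne⟩ : ∃ p : ℝ × ℝ,
        1 + ε * (-p.1 + cubicP d M₁ M₂ (p.2 * (1 + ε * p.1))) ≠ 0 ∧
        (1 + ε * p.1) / (1 + ε * (-p.1 + cubicP d M₁ M₂ (p.2 * (1 + ε * p.1)))) ≠ 1 := by
      by_cases hM : M₁ = 0
      · refine ⟨(-ε⁻¹, 0), ?_, ?_⟩
        · simp [cubicP, hM, hε]
        · simp [hε]
      · exact ⟨(M₁, 0), by simp [cubicP], by simp [cubicP, hε, hM]⟩
    exact ⟨p, hp, by rwa [(perturbedH3_differentiableAt_and_det d M₁ M₂ ε p hp).2]⟩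
  · rintro rfl
    ext p
    · simp [perturbedH3]
    · simp [perturbedH3, cubicP]
      ring
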